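/- (Projective Beth definability direction.) Let σ and σ' be first-order vocabularies with σ ⊆ σ', let Γ be a set of first-order sentences over σ' with at least one model, and let ψ(x̄) be a first-order formula over σ'. If every two models 𝒜 and ℬ of Γ whose reducts to σ are equal satisfy exactly the same instances of ψ (i.e., for every tuple ā, 𝒜 ⊨ ψ(ā) if and only if ℬ ⊨ ψ(ā)), then there exists a first-order formula φ(x̄) over σ that is equivalent to ψ(x̄) on all models of Γ. -/

import Mathlib

open FirstOrder Language

universe u v w

namespace FirstOrder.Language

open Filter

section Compactness

variable {K : FirstOrder.Language.{u, v}}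

/-- Compactness for families of formulas sharing free variables. -/
theorem exists_realize_of_finset {ι : Type (max u v)} {γ : Type w} (F : ι → K.Formula γ)
    (h : ∀ s : Finset ι, ∃ (M : Type (max u v)) (_ : K.Structure M) (_ : Nonempty M) (x : γ → M),
      ∀ i ∈ s, (F i).Realize x) :
    ∃ (M : Type (max u v)) (_ : K.Structure M) (_ : Nonempty M) (x : γ → M),
      ∀ i, (F i).Realize x := by
  classical
  choose M S hM x hx using h
  let U : Ultrafilter (Finset ι) := Ultrafilter.of atTop
  refine ⟨(U : Filter (Finset ι)).Product M, inferInstance, inferInstance,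
    fun c => ((fun s => x s c : ∀ s, M s) : (U : Filter (Finset ι)).Product M), fun i => ?_⟩
  refine (Ultraproduct.realize_formula_cast (F i) fun c s => x s c).2 ?_
  have hU : ∀ᶠ s : Finset ι in atTop, (F i).Realize (x s) :=
    (eventually_ge_atTop {i}).mono fun s hs => hx s i (by simpa using hs)
  exact Ultrafilter.of_le atTop hU

/-- Existential quantification over an arbitrary set of variables of a formula. -/
theorem Formula.exists_realize_iff_exists {B D : Type*} (χ : K.Formula (B ⊕ D)) :
    ∃ χ' : K.Formula D, ∀ (M : Type w) [K.Structure M] [Nonempty M] (p : D → M),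
      χ'.Realize p ↔ ∃ x : B → M, χ.Realize (Sum.elim x p) := by
  classical
  let β := {b : B // Sum.inl b ∈ χ.freeVarFinset}
  have : Finite β := Finite.of_injective
    (fun b : β => (⟨Sum.inl b.1, b.2⟩ : χ.freeVarFinset)) fun a b hab => by
      exact Subtype.ext (by simpa using hab)
  let f : χ.freeVarFinset → D ⊕ β := fun c =>
    match c with
    | ⟨Sum.inl b, hb⟩ => Sum.inr ⟨b, hb⟩
    | ⟨Sum.inr d, _⟩ => Sum.inl d
  have key (M : Type w) [K.Structure M] (p : D → M) (y : β → M) (x : B → M)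
      (hxy : ∀ b : β, y b = x b) :
      Formula.Realize (BoundedFormula.restrictFreeVar χ f) (Sum.elim p y) ↔
        χ.Realize (Sum.elim x p) := by
    refine BoundedFormula.realize_restrictFreeVar _ ?_
    rintro ⟨b | d, hc⟩
    · exact hxy ⟨b, hc⟩
    · rfl
  refine ⟨Formula.iExs β (BoundedFormula.restrictFreeVar χ f), fun M _ _ p => ?_⟩
  rw [Formula.realize_iExs]
  constructor
  · rintro ⟨y, hy⟩
    let x : B → M := fun b => if hb : Sum.inl b ∈ χ.freeVarFinset then y ⟨b, hb⟩
      else Classical.arbitrary M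
    exact ⟨x, (key M p y x fun b => by simp [x, b.2]).1 hy⟩
  · rintro ⟨x, hx⟩
    exact ⟨fun b => x b, (key M p _ x fun _ => rfl).2 hx⟩

/-- The conjunction of a finite set of formulas. -/
theorem Formula.exists_realize_iff_forall_mem {γ : Type*} {ι : Type*} (F : ι → K.Formula γ)
    (s : Finset ι) :
    ∃ χ : K.Formula γ, ∀ (M : Type w) [K.Structure M] (x : γ → M),
      χ.Realize x ↔ ∀ i ∈ s, (F i).Realize x := by
  refine ⟨BoundedFormula.iInf fun i : s => F i, fun M _ x => ?_⟩
  simp [Formula.Realize]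

end Compactness

section Chain

variable {K : FirstOrder.Language.{u, v}} {Y : ℕ → Type w} [∀ n, K.Structure (Y n)]
  (k : ∀ n, Y n ↪ₑ[K] Y (n + 1)) {X : Type w} (j : ∀ n, Y n → X)
  (hjk : ∀ n y, j (n + 1) (k n y) = j n y)

include hjk in
theorem exists_elementaryEmbedding_of_chain {m n : ℕ} (h : m ≤ n) :
    ∃ t : Y m ↪ₑ[K] Y n, ∀ y, j n (t y) = j m y := by
  induction n, h using Nat.le_induction with
  | base => exact ⟨ElementaryEmbedding.refl K _, fun _ => rfl⟩
  | succ n _ ih =>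
    obtain ⟨t, ht⟩ := ih
    exact ⟨(k n).comp t, fun y => by rw [ElementaryEmbedding.comp_apply, hjk, ht]⟩

include hjk in
theorem exists_lift_tuple_of_chain (hsurj : ∀ x, ∃ n y, j n y = x) {m : ℕ} (x : Fin m → X) :
    ∃ n, ∃ y : Fin m → Y n, j n ∘ y = x := by
  choose n y hy using fun i => hsurj (x i)
  choose t ht using fun i => exists_elementaryEmbedding_of_chain k j hjk
    (Finset.le_sup (f := n) (Finset.mem_univ i))
  exact ⟨_, fun i => t i (y i), funext fun i => by simp [ht, hy]⟩

include hjk in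
/-- The Tarski–Vaught elementary chain theorem. -/
theorem exists_structure_of_elementary_chain (hinj : ∀ n, Function.Injective (j n))
    (hsurj : ∀ x, ∃ n y, j n y = x) :
    ∃ _ : K.Structure X, ∀ n, ∃ e : Y n ↪ₑ[K] X, ⇑e = j n := by
  have lift {m : ℕ} (x : Fin m → X) := exists_lift_tuple_of_chain k j hjk hsurj x
  let S : K.Structure X :=
    { funMap := fun f x => j _ (Structure.funMap f (lift x).choose_spec.choose)
      RelMap := fun r x => Structure.RelMap r (lift x).choose_spec.choose }
  have amalg {n n' m : ℕ} (y : Fin m → Y n) (y' : Fin m → Y n') (h : j n ∘ y = j n' ∘ y') :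
      ∃ N, ∃ t : Y n ↪ₑ[K] Y N, ∃ t' : Y n' ↪ₑ[K] Y N, (∀ y, j N (t y) = j n y) ∧
        (∀ y, j N (t' y) = j n' y) ∧ t ∘ y = t' ∘ y' := by
    obtain ⟨t, ht⟩ := exists_elementaryEmbedding_of_chain k j hjk (le_max_left n n')
    obtain ⟨t', ht'⟩ := exists_elementaryEmbedding_of_chain k j hjk (le_max_right n n')
    exact ⟨_, t, t', ht, ht', funext fun i => hinj _ (by simpa [ht, ht'] using congrFun h i)⟩
  have hfun {n m : ℕ} (f : K.Functions m) (y : Fin m → Y n) :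
      Structure.funMap f (j n ∘ y) = j n (Structure.funMap f y) := by
    obtain ⟨N, t, t', ht, ht', h⟩ := amalg _ _ (lift (j n ∘ y)).choose_spec.choose_spec
    change j _ (Structure.funMap f (lift (j n ∘ y)).choose_spec.choose) = _
    rw [← ht, ← ht', t.map_fun, t'.map_fun, h]
  have hrel {n m : ℕ} (r : K.Relations m) (y : Fin m → Y n) :
      Structure.RelMap r (j n ∘ y) ↔ Structure.RelMap r y := by
    obtain ⟨N, t, t', ht, ht', h⟩ := amalg _ _ (lift (j n ∘ y)).choose_spec.choose_spec
    change Structure.RelMap r (lift (j n ∘ y)).choose_spec.choose ↔ _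
    rw [← t.map_rel, ← t'.map_rel, h]
  have hemb (n : ℕ) : ∃ e : Y n ↪[K] X, ⇑e = j n :=
    ⟨⟨⟨j n, hinj n⟩, fun f y => (hfun f y).symm, fun r y => hrel r y⟩, rfl⟩
  choose e he using hemb
  have hterm {n : ℕ} {γ : Type} (t : K.Term γ) (x : γ → Y n) :
      t.realize (j n ∘ x) = j n (t.realize x) := by
    rw [← he]
    exact HomClass.realize_term (e n)
  have main {γ : Type} {m : ℕ} (φ : K.BoundedFormula γ m) :
      ∀ n (x : γ → Y n) (xs : Fin m → Y n),
        φ.Realize (j n ∘ x) (j n ∘ xs) ↔ φ.Realize x xs := by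
    induction φ with
    | falsum => exact fun _ _ _ => Iff.rfl
    | equal t₁ t₂ =>
      intro n x xs
      simp only [BoundedFormula.Realize, ← Sum.comp_elim, hterm]
      exact (hinj n).eq_iff
    | rel r ts =>
      intro n x xs
      simp only [BoundedFormula.Realize, ← Sum.comp_elim, hterm]
      exact hrel r _
    | imp _ _ ih₁ ih₂ =>
      intro n x xs
      simp only [BoundedFormula.Realize, ih₁, ih₂]
    | all φ ih =>
      intro n x xs
      constructor
      · intro h a
        have := h (j n a)
        rwa [← Fin.comp_snoc, ih] at this
      · intro h b
        obtain ⟨n', b, rfl⟩ := hsurj b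
        obtain ⟨t, ht⟩ := exists_elementaryEmbedding_of_chain k j hjk (le_max_left n n')
        obtain ⟨t', ht'⟩ := exists_elementaryEmbedding_of_chain k j hjk (le_max_right n n')
        have := (t.map_boundedFormula φ.all x xs).2 h (t' b)
        have hx {δ : Type} (z : δ → Y n) : j n ∘ z = j (max n n') ∘ (t ∘ z) :=
          funext fun i => (ht _).symm
        rw [hx, hx, ← ht', ← Fin.comp_snoc, ih]
        exact this
  exact ⟨S, fun n => ⟨⟨j n, fun m φ x => by
    have := main φ n x default
    rwa [Subsingleton.elim (j n ∘ default) default] at this⟩, rfl⟩⟩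

end Chain

/-- Two structures agree if every finite tuple lifts along maps that are embeddings for both. -/
theorem structure_eq_of_embeddings {K : FirstOrder.Language.{u, v}} {ι : Type*} {Y : ι → Type w}
    [∀ n, K.Structure (Y n)] {X : Type w} (j : ∀ n, Y n → X)
    (lift : ∀ (m : ℕ) (x : Fin m → X), ∃ n, ∃ y : Fin m → Y n, j n ∘ y = x)
    (S T : K.Structure X)
    (hS : ∀ n, ∃ e : @Embedding K (Y n) X _ S, e.toFun = j n)
    (hT : ∀ n, ∃ e : @Embedding K (Y n) X _ T, e.toFun = j n) : S = T := by
  ext m f x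
  · obtain ⟨n, y, rfl⟩ := lift m x
    obtain ⟨e, he⟩ := hS n
    obtain ⟨e', he'⟩ := hT n
    have h := @Embedding.map_fun' K _ _ _ S e _ f y
    have h' := @Embedding.map_fun' K _ _ _ T e' _ f y
    rw [he] at h
    rw [he'] at h'
    exact h.symm.trans h'
  · obtain ⟨n, y, rfl⟩ := lift m x
    obtain ⟨e, he⟩ := hS n
    obtain ⟨e', he'⟩ := hT n
    have h := @Embedding.map_rel' K _ _ _ S e _ f y
    have h' := @Embedding.map_rel' K _ _ _ T e' _ f y
    rw [he] at h
    rw [he'] at h'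
    exact h.trans h'.symm

section Expansion

/-- A nonempty structure for the codomain of `φ`, carrying also its reduct along `φ`. -/
structure ExpandedStructure {L L' : FirstOrder.Language.{u, v}} (φ : L →ᴸ L') where
  /-- The underlying type. -/
  carrier : Type (max u v)
  [struc : L'.Structure carrier]
  [nonempty : Nonempty carrier]

variable {L L' : FirstOrder.Language.{u, v}} {φ : L →ᴸ L'}

namespace ExpandedStructure

instance : CoeSort (ExpandedStructure φ) (Type (max u v)) := ⟨carrier⟩

instance (A : ExpandedStructure φ) : L'.Structure A := A.struc

instance (A : ExpandedStructure φ) : Nonempty A := A.nonempty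

instance (A : ExpandedStructure φ) : L.Structure A := φ.reduct A

instance (A : ExpandedStructure φ) : φ.IsExpansionOn A := LHom.isExpansionOn_reduct φ A

end ExpandedStructure

/-- Compactness for families of formulas, relative to a theory. -/
theorem exists_expandedStructure_realize_of_finset (Γ : L'.Theory) {ι : Type (max u v)}
    {γ : Type w} (F : ι → L'.Formula γ)
    (h : ∀ s : Finset ι, ∃ (C : ExpandedStructure φ) (_ : C ⊨ Γ) (x : γ → C),
      ∀ i ∈ s, (F i).Realize x) :
    ∃ (C : ExpandedStructure φ) (_ : C ⊨ Γ) (x : γ → C), ∀ i, (F i).Realize x := by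
  classical
  let G : Γ ⊕ ι → L'.Formula γ := Sum.elim (fun θ => Formula.relabel Empty.elim θ.1) F
  have hG (M : Type (max u v)) [L'.Structure M] (x : γ → M) (θ : Γ) :
      (G (Sum.inl θ)).Realize x ↔ M ⊨ θ.1 := by
    simp only [G, Sum.elim_inl, Formula.realize_relabel, Sentence.Realize]
    rw [Subsingleton.elim (x ∘ Empty.elim) default]
  obtain ⟨M, S, hM, x, hx⟩ := exists_realize_of_finset G fun s => by
    obtain ⟨C, hC, x, hx⟩ := h s.toRight
    refine ⟨C, inferInstance, inferInstance, x, ?_⟩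
    rintro (θ | i) hi
    · exact (hG C x θ).2 (hC.realize_of_mem _ θ.2)
    · exact hx i (by simpa using hi)
  exact ⟨⟨M⟩, ⟨fun θ hθ => (hG M x ⟨θ, hθ⟩).1 (hx _)⟩, x, fun i => hx (Sum.inr i)⟩

/-- Two expansions with tuples of the same type over the small language embed compatibly into a
third one: elementarily over the big language for the first, over the small one for the second. -/
theorem exists_amalgam (A B : ExpandedStructure φ) {D : Type (max u v)} (p : D → A) (q : D → B)
    (h : ∀ θ : L.Formula D, θ.Realize q → θ.Realize p) :
    ∃ (C : ExpandedStructure φ) (e : A ↪ₑ[L'] C) (g : B ↪ₑ[L] C), ∀ d, g (q d) = e (p d) := by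
  classical
  let I := {θ : L'.Formula A // θ.Realize (id : A → A)}
  let J := {χ : L.Formula (B ⊕ D) // χ.Realize (Sum.elim id q)}
  let F : I ⊕ J → L'.Formula (A ⊕ B) := Sum.elim
    (fun θ => θ.1.relabel Sum.inl)
    (fun χ => (φ.onFormula χ.1).relabel (Sum.elim Sum.inr (Sum.inl ∘ p)))
  obtain ⟨C, x, hx⟩ : ∃ (C : ExpandedStructure φ) (x : A ⊕ B → C), ∀ i, (F i).Realize x := by
    refine (exists_expandedStructure_realize_of_finset ∅ F fun s => ?_).imp fun C h => h.2
    obtain ⟨χ, hχ⟩ := Formula.exists_realize_iff_forall_mem.{u, v, max u v} (fun c : J => c.1)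
      s.toRight
    obtain ⟨χ', hχ'⟩ := Formula.exists_realize_iff_exists.{u, v, max u v} χ
    obtain ⟨y, hy⟩ := (hχ' A p).1 (h χ' ((hχ' B q).2 ⟨id, (hχ B _).2 fun i _ => i.2⟩))
    refine ⟨A, ⟨fun _ h => h.elim⟩, Sum.elim id y, ?_⟩
    rintro (θ | χ) hi
    · simpa [F, Formula.realize_relabel] using θ.2
    · have h1 := (hχ A _).1 hy χ (by simpa using hi)
      simp only [F, Sum.elim_inr, Formula.realize_relabel, LHom.realize_onFormula]
      convert h1 using 1
      ext (b | d) <;> rfl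
  have hI (θ : L'.Formula A) (hθ : θ.Realize (id : A → A)) : θ.Realize (x ∘ Sum.inl) := by
    have := hx (Sum.inl ⟨θ, hθ⟩)
    simpa [F, Formula.realize_relabel] using this
  have hJ (χ : L.Formula (B ⊕ D)) (hχ : χ.Realize (Sum.elim id q)) :
      χ.Realize (Sum.elim (x ∘ Sum.inr) (x ∘ Sum.inl ∘ p)) := by
    have : (φ.onFormula χ).Realize (x ∘ Sum.elim Sum.inr (Sum.inl ∘ p)) :=
      Formula.realize_relabel.1 (hx (Sum.inr ⟨χ, hχ⟩))
    rw [LHom.realize_onFormula] at this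
    convert this using 1
    ext (b | d) <;> rfl
  refine ⟨C, ⟨x ∘ Sum.inl, fun n θ y => ?_⟩, ⟨x ∘ Sum.inr, fun n θ y => ?_⟩, fun d => ?_⟩
  · have h1 := hI (θ.relabel y)
    have h2 := hI (θ.relabel y).not
    simp only [Formula.realize_not, Formula.realize_relabel, Function.id_comp] at h1 h2
    exact not_imp_not.1 h2 |> fun h => ⟨h, h1⟩
  · have h1 := hJ (θ.relabel (Sum.inl ∘ y))
    have h2 := hJ (θ.relabel (Sum.inl ∘ y)).not
    simp only [Formula.realize_not, Formula.realize_relabel, ← Function.comp_assoc,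
      Sum.elim_comp_inl, Function.id_comp] at h1 h2
    exact ⟨not_imp_not.1 h2, h1⟩
  · have h1 : x (Sum.inr (q d)) = x (Sum.inl (p d)) := by
      have := hJ (Term.equal (Term.var (Sum.inl (q d))) (Term.var (Sum.inr d)))
      simpa [Formula.realize_equal] using this
    exact h1

variable (φ) in
/-- A link of the alternating chain used to merge two expansions. -/
structure AlternatingLink where
  /-- The source of the link. -/
  source : ExpandedStructure φ
  /-- The target of the link. -/
  target : ExpandedStructure φ
  /-- The embedding, elementary over the small language. -/
  map : source ↪ₑ[L] target

theorem AlternatingLink.exists_next (l : AlternatingLink φ) :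
    ∃ (C : ExpandedStructure φ) (e : l.source ↪ₑ[L'] C) (g : l.target ↪ₑ[L] C),
      ∀ d, g (l.map d) = e d :=
  exists_amalgam l.source l.target id l.map fun θ hθ => (l.map.map_formula θ id).1 hθ

/-- The link following a given one: the composite of the two is elementary over the big language. -/
noncomputable def AlternatingLink.next (l : AlternatingLink φ) : AlternatingLink φ :=
  ⟨l.target, l.exists_next.choose, l.exists_next.choose_spec.choose_spec.choose⟩

/-- Two expansions, one embedded elementarily over the small language in the other, have
elementary extensions over the big language with the same reduct to the small language. -/
theorem exists_common_reduct (l : AlternatingLink φ) :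
    ∃ (X : Type (max u v)) (S T : L'.Structure X) (f : l.source → X) (g : l.target → X),
      @LHom.reduct L L' φ X S = @LHom.reduct L L' φ X T ∧
      (∃ e : @ElementaryEmbedding L' l.source X _ S, @ElementaryEmbedding.toFun L' _ _ _ S e = f) ∧
      (∃ e : @ElementaryEmbedding L' l.target X _ T, @ElementaryEmbedding.toFun L' _ _ _ T e = g) ∧
      ∀ a, g (l.map a) = f a := by
  let s : ℕ → AlternatingLink φ := fun n => Nat.rec l (fun _ => AlternatingLink.next) n
  let Y : ℕ → ExpandedStructure φ := fun n => (s n).source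
  let k : ∀ n, Y n ↪ₑ[L] Y (n + 1) := fun n => (s n).map
  have hE (n : ℕ) : ∃ e : Y n ↪ₑ[L'] Y (n + 2), ∀ a, k (n + 1) (k n a) = e a :=
    ⟨(s n).exists_next.choose_spec.choose, (s n).exists_next.choose_spec.choose_spec.choose_spec⟩
  choose E hE using hE
  let t := DirectedSystem.natLERec (L := L) (G' := fun n => Y n) fun n => (k n).toEmbedding
  let X := DirectLimit (L := L) (fun n => Y n) t
  let j : ∀ n, Y n ↪[L] X := fun n => DirectLimit.of L ℕ (fun n => Y n) t n
  have hjt {m n : ℕ} (h : m ≤ n) (a : Y m) : j n (t m n h a) = j m a := DirectLimit.of_f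
  have hjk (n : ℕ) (a : Y n) : j (n + 1) (k n a) = j n a := by
    rw [← hjt (Nat.le_succ n) a]
    congr 1
    simp only [t, DirectedSystem.coe_natLERec]
    exact (Nat.leRecOn_succ' (C := fun n => Y n) (next := fun {n} => k n) a).symm
  have par (c : ℕ) : ∃ S : L'.Structure X, @LHom.reduct L L' φ X S = (inferInstance : L.Structure X) ∧
      ∃ e : @ElementaryEmbedding L' (Y c) X _ S, @ElementaryEmbedding.toFun L' _ _ _ S e = j c := by
    have hj2 (n : ℕ) (a : Y (c + 2 * n)) : j (c + 2 * (n + 1)) (E (c + 2 * n) a) =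
        j (c + 2 * n) a := by
      rw [← hE]
      exact (hjk (c + 2 * n + 1) _).trans (hjk (c + 2 * n) a)
    have hsurj (x : X) : ∃ n, ∃ y : Y (c + 2 * n), j (c + 2 * n) y = x := by
      obtain ⟨m, y, rfl⟩ := DirectLimit.exists_of x
      exact ⟨m, t m _ (by omega) y, hjt _ y⟩
    obtain ⟨S, hS⟩ := exists_structure_of_elementary_chain (Y := fun n => Y (c + 2 * n))
      (fun n => E (c + 2 * n)) (fun n => j (c + 2 * n)) hj2 (fun n => (j _).injective) hsurj
    refine ⟨S, ?_, (hS 0).imp fun e he => he⟩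
    refine structure_eq_of_embeddings (Y := fun n => Y (c + 2 * n)) (fun n => j (c + 2 * n))
      (fun m x => exists_lift_tuple_of_chain (Y := fun n => Y (c + 2 * n))
        (fun n => E (c + 2 * n)) (fun n => j (c + 2 * n)) hj2 hsurj x) _ _ (fun n => ?_)
      fun n => ⟨j _, rfl⟩
    obtain ⟨e, he⟩ := hS n
    let _ := φ.reduct X
    exact ⟨⟨⟨e, e.injective⟩, fun f y => e.map_fun (φ.onFunction f) y,
      fun r y => e.map_rel (φ.onRelation r) y⟩, he⟩
  obtain ⟨S, hS, e, he⟩ := par 0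
  obtain ⟨T, hT, e', he'⟩ := par 1
  exact ⟨X, S, T, j 0, j 1, hS.trans hT.symm, ⟨e, he⟩, ⟨e', he'⟩, hjk 0⟩

/-- If `ψ` is not equivalent modulo `Γ` to a formula over the small language, then two models of
`Γ` with tuples of the same type over the small language disagree on `ψ`. -/
theorem exists_same_type_of_not_definable (Γ : L'.Theory) {α : Type} (ψ : L'.Formula α)
    (h : ¬ ∃ θ : L.Formula α, ∀ C : ExpandedStructure φ, C ⊨ Γ → ∀ x : α → C,
      ψ.Realize x ↔ θ.Realize x) :
    ∃ (A B : ExpandedStructure φ) (_ : A ⊨ Γ) (_ : B ⊨ Γ) (a : α → A) (b : α → B),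
      ψ.Realize a ∧ ¬ ψ.Realize b ∧ ∀ θ : L.Formula α, θ.Realize b → θ.Realize a := by
  let I := {θ : L.Formula α // ∀ C : ExpandedStructure φ, C ⊨ Γ → ∀ x : α → C,
    ψ.Realize x → θ.Realize x}
  obtain ⟨B, hB, b, hb⟩ := exists_expandedStructure_realize_of_finset (φ := φ) Γ
    (fun i : Option I => i.elim ψ.not fun θ => φ.onFormula θ.1) fun s => by
      obtain ⟨χ, hχ⟩ := Formula.exists_realize_iff_forall_mem.{u, v, max u v}
        (fun θ : I => θ.1) s.eraseNone
      by_contra! hs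
      refine h ⟨χ, fun C hC x => ⟨fun hx => (hχ C x).2 fun θ _ => θ.2 C hC x hx, fun hx => ?_⟩⟩
      obtain ⟨i, hi, hix⟩ := hs C hC x
      cases i with
      | none => simpa using hix
      | some θ => exact absurd ((φ.realize_onFormula _).2 ((hχ C x).1 hx θ (by simpa using hi))) hix
  have hbψ : ¬ ψ.Realize b := by simpa using hb none
  have hbI (θ : I) : θ.1.Realize b := (φ.realize_onFormula _).1 (hb (some θ))
  let J := {θ : L.Formula α // θ.Realize b}
  obtain ⟨A, hA, a, ha⟩ := exists_expandedStructure_realize_of_finset (φ := φ) Γ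
    (fun i : Option J => i.elim ψ fun θ => φ.onFormula θ.1) fun s => by
      obtain ⟨χ, hχ⟩ := Formula.exists_realize_iff_forall_mem.{u, v, max u v}
        (fun θ : J => θ.1) s.eraseNone
      by_contra! hs
      have hbχ : χ.Realize b := (hχ B b).2 fun θ _ => θ.2
      refine Formula.realize_not.1 (hbI ⟨χ.not, fun C hC x hx => ?_⟩) hbχ
      refine Formula.realize_not.2 fun hχx => ?_
      obtain ⟨i, hi, hix⟩ := hs C hC x
      cases i with
      | none => exact hix hx
      | some θ =>
        exact hix ((φ.realize_onFormula _).2 ((hχ C x).1 hχx θ (by simpa using hi)))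
  exact ⟨A, B, hA, hB, a, b, ha none, hbψ,
    fun θ hθ => (φ.realize_onFormula _).1 (ha (some ⟨θ, hθ⟩))⟩

/-- Projective Beth definability along an arbitrary language homomorphism. -/
theorem exists_formula_of_implicit_definability (Γ : L'.Theory) {α : Type} (ψ : L'.Formula α)
    (himp : ∀ (X : Type (max u v)) (S T : L'.Structure X), Nonempty X →
      @Theory.Model _ X S Γ → @Theory.Model _ X T Γ →
      @LHom.reduct L L' φ X S = @LHom.reduct L L' φ X T →
      ∀ x : α → X, @Formula.Realize _ X S α ψ x ↔ @Formula.Realize _ X T α ψ x) :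
    ∃ θ : L.Formula α, ∀ C : ExpandedStructure φ, C ⊨ Γ → ∀ x : α → C,
      ψ.Realize x ↔ θ.Realize x := by
  by_contra h
  obtain ⟨A, B, hA, hB, a, b, ha, hb, hab⟩ := exists_same_type_of_not_definable Γ ψ h
  let D := Set.range fun i => (a i, b i)
  choose c hc using fun d : D => d.2
  obtain ⟨C, e, g, hge⟩ := exists_amalgam A B (fun d : D => d.1.1) (fun d : D => d.1.2)
    fun θ hθ => by
      have hca : a ∘ c = fun d : D => d.1.1 := funext fun d => congrArg Prod.fst (hc d)
      have hcb : b ∘ c = fun d : D => d.1.2 := funext fun d => congrArg Prod.snd (hc d)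
      have := hab (θ.relabel c)
      rw [Formula.realize_relabel, Formula.realize_relabel, hca, hcb] at this
      exact this hθ
  have hgb (i : α) : g (b i) = e (a i) := hge ⟨_, i, rfl⟩
  obtain ⟨X, S, T, f, f', hST, ⟨k, hk⟩, ⟨k', hk'⟩, hf⟩ := exists_common_reduct ⟨B, C, g⟩
  have hS : @Theory.Model _ X S Γ := (@ElementaryEmbedding.theory_model_iff _ _ _ _ S k Γ).1 hB
  have hT : @Theory.Model _ X T Γ := (@ElementaryEmbedding.theory_model_iff _ _ _ _ T k' Γ).1
    ((e.theory_model_iff Γ).1 hA)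
  have key := himp X S T ⟨f B.nonempty.some⟩ hS hT hST (f ∘ b)
  have h1 : ¬ @Formula.Realize _ X S α ψ (f ∘ b) := by
    rw [← hk]
    exact fun h => hb ((@ElementaryEmbedding.map_formula _ _ _ _ S k α ψ b).1 h)
  have h2 : @Formula.Realize _ X T α ψ (f ∘ b) := by
    have : f ∘ b = k'.toFun ∘ e ∘ a := by
      rw [hk']
      exact funext fun i => ((hf (b i)).symm.trans (congrArg f' (hgb i)))
    rw [this]
    exact (@ElementaryEmbedding.map_formula _ _ _ _ T k' α ψ (e ∘ a)).2 ((e.map_formula ψ a).2 ha)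
  exact h1 (key.2 h2)

end Expansion

end FirstOrder.Language

/-- **Projective Beth definability (implicit definability implies explicit definability).**
Vocabularies `σ ⊆ σ'` are modelled as `σ' = L.sum L₂` (the language `L` together with fresh
symbols `L₂`), with the inclusion `LHom.sumInl : L →ᴸ L.sum L₂`; the reduct of a
`σ'`-structure to `σ` is `LHom.sumInl.reduct`.  Assume `Γ` has at least one (nonempty) model.
If any two models of `Γ` with equal `σ`-reducts satisfy exactly the same instances of `ψ`,
then some `σ`-formula `φ` is equivalent to `ψ` on all models of `Γ`. -/
theorem projective_beth_definability
    {L L₂ : FirstOrder.Language.{u, v}} (Γ : (L.sum L₂).Theory) {α : Type w}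
    (ψ : (L.sum L₂).Formula α)
    (hsat : ∃ (M : Type (max u v)) (S : (L.sum L₂).Structure M),
      Nonempty M ∧ @Theory.Model _ M S Γ)
    (himp : ∀ (M : Type (max u v)) (SA SB : (L.sum L₂).Structure M), Nonempty M →
      @Theory.Model _ M SA Γ → @Theory.Model _ M SB Γ →
      @LHom.reduct L (L.sum L₂) LHom.sumInl M SA =
        @LHom.reduct L (L.sum L₂) LHom.sumInl M SB →
      ∀ a : α → M, @Formula.Realize _ M SA α ψ a ↔ @Formula.Realize _ M SB α ψ a) :
    ∃ φ : L.Formula α,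
      ∀ (M : Type (max u v)) (S : (L.sum L₂).Structure M), Nonempty M →
        @Theory.Model _ M S Γ →
        ∀ a : α → M,
          @Formula.Realize _ M S α ψ a ↔
            @Formula.Realize L M (@LHom.reduct L (L.sum L₂) LHom.sumInl M S) α φ a := by
  classical
  let n := ψ.freeVarFinset.card
  let r : ψ.freeVarFinset ≃ Fin n := ψ.freeVarFinset.equivFin
  let i : Fin n → α := fun c => (r.symm c).1
  let ψ' : (L.sum L₂).Formula (Fin n) := BoundedFormula.restrictFreeVar ψ r
  have hψ' (M : Type (max u v)) (S : (L.sum L₂).Structure M) (x : Fin n → M) (y : α → M)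
      (h : y ∘ i = x) : ψ'.Realize x ↔ ψ.Realize y :=
    BoundedFormula.realize_restrictFreeVar y fun c => by simp [← h, i]
  have hi : Function.Injective i := Subtype.val_injective.comp r.symm.injective
  obtain ⟨θ, hθ⟩ := exists_formula_of_implicit_definability (φ := (LHom.sumInl : L →ᴸ L.sum L₂)) Γ ψ'
    fun M S T hM hS hT hST x => by
      obtain ⟨y, rfl⟩ := hi.surjective_comp_right (γ := M) x
      rw [hψ' M S _ y rfl, hψ' M T _ y rfl]
      exact himp M S T hM hS hT hST y
  refine ⟨θ.relabel i, fun M S hM hS a => ?_⟩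
  let _ : L.Structure M := (LHom.sumInl : L →ᴸ L.sum L₂).reduct M
  rw [Formula.realize_relabel, ← hψ' M S _ a rfl]
  exact hθ ⟨M⟩ hS _
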